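/- Let L = D^{n+1} + Σ_{i=0}^n a_i D^i (n ≥ 1) have characteristic polynomial p_L which is an even or an odd polynomial and has at least one nonreal root. Let S be the unique element of E_L with S(0) = ⋯ = S^{(n−1)}(0) = 0, S^{(n)}(0) = 1, and W_k(h) := det((S^{(i+j)}(h))_{0 ≤ i,j ≤ k}). Then ℓ_L = min_{0 ≤ k ≤ ⌊(n−1)/2⌋} inf{h > 0 : W_k(h) = 0}, with the convention inf ∅ = +∞. -/

import Mathlib

open scoped BigOperators

noncomputable section

/-- `F` vanishes to order at least `m` at `x`: all derivatives of order `< m` vanish at `x`. -/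
def VanishAtLeast (F : ℝ → ℝ) (m : ℕ) (x : ℝ) : Prop :=
  ∀ j < m, iteratedDeriv j F x = 0

/-- `F` vanishes at most `N` times in `J`, counting multiplicities up to `μ`. -/
def VanishAtMost (F : ℝ → ℝ) (μ N : ℕ) (J : Set ℝ) : Prop :=
  ∀ (r : ℕ) (xs : Fin r → ℝ) (m : Fin r → ℕ),
    (∀ i, xs i ∈ J) → Function.Injective xs →
    (∀ i, 1 ≤ m i) → (∀ i, m i ≤ μ) →
    (∀ i, VanishAtLeast F (m i) (xs i)) →
    ∑ i, m i ≤ N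

/-- Kernel of the operator `L = D^(n+1) + ∑_{i=0}^n a i • D^i`. -/
def kerOp (n : ℕ) (a : Fin (n + 1) → ℝ) : Set (ℝ → ℝ) :=
  {F | ContDiff ℝ (⊤ : ℕ∞) F ∧
    ∀ x : ℝ, iteratedDeriv (n + 1) F x + ∑ i : Fin (n + 1), a i * iteratedDeriv (i : ℕ) F x = 0}

/-- The (restriction of the) kernel of `L` is an Extended Chebyshev space on `J`. -/
def IsECOn (n : ℕ) (a : Fin (n + 1) → ℝ) (J : Set ℝ) : Prop :=
  ∀ F ∈ kerOp n a, F ≠ 0 → VanishAtMost F (n + 1) n J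

/-- Critical length of the operator `L = D^(n+1) + ∑ a i • D^i`, as an extended real. -/
def critLen (n : ℕ) (a : Fin (n + 1) → ℝ) : EReal :=
  sSup {l : EReal | ∃ h : ℝ, l = (h : EReal) ∧ 0 < h ∧ IsECOn n a (Set.Icc 0 h)}

/-- The Wronskian of `(S, S', …, S^(k))` at `h`, i.e. `det ((S^(i+j)(h))_{0 ≤ i,j ≤ k})`. -/
def WronS (S : ℝ → ℝ) (k : ℕ) (h : ℝ) : ℝ :=
  (Matrix.of fun i j : Fin (k + 1) => iteratedDeriv ((i : ℕ) + (j : ℕ)) S h).det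

/-- A nondecreasing sequence of `N` zeros of `F`, repeated according to multiplicity. -/
def ZSeq (F : ℝ → ℝ) (N : ℕ) (x : ℕ → ℝ) : Prop :=
  (∀ i j, i ≤ j → j < N → x i ≤ x j) ∧
    ∀ i j, i + j < N → x i = x (i + j) → iteratedDeriv j F (x i) = 0

lemma zseq_low {F : ℝ → ℝ} {N : ℕ} {x : ℕ → ℝ} (h : ZSeq F N x) {i j : ℕ} (hij : i + j < N)
    (hx : x i = x (i + j)) : ∀ l ≤ j, iteratedDeriv l F (x i) = 0 := by
  intro l hl
  refine h.2 i l (by omega) (le_antisymm (h.1 _ _ (by omega) (by omega)) ?_)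
  rw [hx]
  exact h.1 _ _ (by omega) (by omega)

lemma exists_zseq {F : ℝ → ℝ} {r : ℕ} {xs : Fin r → ℝ} {m : Fin r → ℕ}
    (hinj : Function.Injective xs) (hv : ∀ i, VanishAtLeast F (m i) (xs i)) {N : ℕ}
    (hN : N ≤ ∑ i, m i) : ∃ x : ℕ → ℝ, ZSeq F N x ∧ ∀ i < N, ∃ j, x i = xs j := by
  classical
  set M : Multiset ℝ := ∑ i, Multiset.replicate (m i) (xs i) with hM
  set l := M.sort (· ≤ ·) with hl
  have hlM : (l : Multiset ℝ) = M := Multiset.sort_eq _ _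
  have hlen : l.length = ∑ i, m i := by
    rw [hl, Multiset.length_sort, hM]
    simp
  have hmem : ∀ y ∈ l, ∃ j, y = xs j := by
    intro y hy
    rw [hl, Multiset.mem_sort, hM, Multiset.mem_sum] at hy
    obtain ⟨j, -, hj⟩ := hy
    exact ⟨j, Multiset.eq_of_mem_replicate hj⟩
  have hcount : ∀ j, l.count (xs j) = m j := by
    intro j
    rw [← Multiset.coe_count, hlM, hM, Multiset.count_sum']
    simp [Multiset.count_replicate, hinj.eq_iff]
  have hsort : l.Pairwise (· ≤ ·) := Multiset.pairwise_sort _ _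
  have hmono : ∀ i j (hj : j < l.length) (hij : i ≤ j), l[i] ≤ l[j] := by
    intro i j hj hij
    rcases hij.eq_or_lt with h | h
    · subst h; exact le_rfl
    · exact List.pairwise_iff_getElem.1 hsort i j (by omega) hj h
  refine ⟨fun i => if h : i < l.length then l[i] else 0, ⟨?_, ?_⟩, ?_⟩
  · intro i j hij hj
    have h1 : j < l.length := by omega
    have h2 : i < l.length := by omega
    simp only [h1, h2, dif_pos]
    exact hmono i j h1 hij
  · intro i j hij
    have h1 : i + j < l.length := by omega
    have h2 : i < l.length := by omega
    simp only [h1, h2, dif_pos]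
    intro he
    obtain ⟨q, hq⟩ := hmem l[i] (List.getElem_mem _)
    rw [hq]
    apply hv
    rw [← hcount]
    have hsub : ((l.drop i).take (j + 1)).Sublist l :=
      (List.take_sublist _ _).trans (List.drop_sublist _ _)
    have hrep : (l.drop i).take (j + 1) = List.replicate (j + 1) (xs q) := by
      rw [List.eq_replicate_iff]
      constructor
      · simp; omega
      · intro b hb
        obtain ⟨t, ht, rfl⟩ := List.mem_iff_getElem.1 hb
        simp only [List.getElem_take, List.getElem_drop]
        simp at ht
        rw [← hq]
        apply le_antisymm
        · rw [he]; exact hmono _ _ h1 (by omega)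
        · exact hmono _ _ _ (by omega)
    have := hsub.count_le (xs q)
    rw [hrep, List.count_replicate_self] at this
    omega
  · intro i hi
    have h2 : i < l.length := by omega
    simp only [h2, dif_pos]
    exact hmem _ (List.getElem_mem _)

lemma zseq_rolle {F : ℝ → ℝ} {N : ℕ} {x : ℕ → ℝ} {I : Set ℝ} (hI : I.OrdConnected)
    (hF : ContinuousOn F I) (h : ZSeq F (N + 1) x) (hx : ∀ i < N + 1, x i ∈ I) :
    ∃ y, ZSeq (deriv F) N y ∧ ∀ i < N, y i ∈ I := by
  have key : ∀ i, ∃ y, i < N → (x i = x (i + 1) → y = x i) ∧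
      (x i < x (i + 1) → x i < y ∧ y < x (i + 1)) ∧ deriv F y = 0 := by
    intro i
    by_cases hi : i < N
    swap
    · exact ⟨0, fun h => absurd h hi⟩
    rcases (h.1 i (i + 1) (by omega) (by omega)).eq_or_lt with he | hlt
    · refine ⟨x i, fun _ => ⟨fun _ => rfl, fun h => absurd h (by rw [he]; exact lt_irrefl _), ?_⟩⟩
      simpa using h.2 i 1 (by omega) he
    · have h0 : F (x i) = 0 := by simpa using h.2 i 0 (by omega) rfl
      have h1 : F (x (i + 1)) = 0 := by simpa using h.2 (i + 1) 0 (by omega) rfl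
      obtain ⟨c, hc, hc'⟩ := exists_deriv_eq_zero hlt
        (hF.mono (hI.out (hx i (by omega)) (hx (i + 1) (by omega)))) (h0.trans h1.symm)
      exact ⟨c, fun _ => ⟨fun h => absurd h hlt.ne, fun _ => ⟨hc.1, hc.2⟩, hc'⟩⟩
  choose y hy using key
  have hle : ∀ i < N, x i ≤ y i ∧ y i ≤ x (i + 1) := by
    intro i hi
    rcases (h.1 i (i + 1) (by omega) (by omega)).eq_or_lt with he | hlt
    · rw [(hy i hi).1 he, ← he]; simp
    · exact ⟨((hy i hi).2.1 hlt).1.le, ((hy i hi).2.1 hlt).2.le⟩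
  have hstr : ∀ i < N, y i = x i ∨ y i = x (i + 1) → x i = x (i + 1) ∧ y i = x i := by
    intro i hi hor
    rcases (h.1 i (i + 1) (by omega) (by omega)).eq_or_lt with he | hlt
    · exact ⟨he, (hy i hi).1 he⟩
    · have := (hy i hi).2.1 hlt
      rcases hor with h | h <;> linarith
  refine ⟨y, ⟨?_, ?_⟩, ?_⟩
  · intro i j hij hj
    rcases hij.eq_or_lt with he | hlt
    · rw [he]
    · exact (hle i (by omega)).2.trans ((h.1 _ _ hlt (by omega)).trans (hle j hj).1)
  · intro i j hij he
    rcases Nat.eq_zero_or_pos j with rfl | hj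
    · simpa using (hy i (by omega)).2.2
    · have a1 := hle i (by omega)
      have a2 := hle (i + j) hij
      have a3 := h.1 (i + 1) (i + j) (by omega) (by omega)
      have b1 := hstr i (by omega) (Or.inr (by linarith))
      have b2 := hstr (i + j) hij (Or.inl (by linarith))
      rw [← iteratedDeriv_succ', b1.2]
      apply h.2 i (j + 1) (by omega)
      rw [← b1.2, he, b2.2, b2.1]; rfl
  · intro i hi
    exact hI.out (hx i (by omega)) (hx (i + 1) (by omega)) (hle i hi)

lemma leib {f g : ℝ → ℝ} {x : ℝ} (hf : ContDiffAt ℝ (⊤ : ℕ∞) f x)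
    (hg : ContDiffAt ℝ (⊤ : ℕ∞) g x) {j : ℕ} (h : ∀ l ≤ j, iteratedDeriv l f x = 0) :
    iteratedDeriv j (f * g) x = 0 := by
  rw [iteratedDeriv_mul (hf.of_le (by exact_mod_cast le_top)) (hg.of_le (by exact_mod_cast le_top))]
  apply Finset.sum_eq_zero
  intro i hi
  rw [h i (by simp at hi; omega)]; simp

lemma polya {I : Set ℝ} (hI : I.OrdConnected) (hIo : IsOpen I) (n : ℕ) : ∀ u : ℕ → ℝ → ℝ,
    (∀ i, ContDiffOn ℝ (⊤ : ℕ∞) (u i) I) →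
    (∀ k ≤ n, ∀ x ∈ I, ∀ c : ℕ → ℝ,
      (∀ j ≤ k, iteratedDeriv j (fun t => ∑ i ∈ Finset.range (k + 1), c i * u i t) x = 0) →
      ∀ i ≤ k, c i = 0) →
    ∀ (c : ℕ → ℝ) (x : ℕ → ℝ), (∀ i < n + 1, x i ∈ I) →
      ZSeq (fun t => ∑ i ∈ Finset.range (n + 1), c i * u i t) (n + 1) x →
      ∀ i ≤ n, c i = 0 := by
  induction n with
  | zero =>
    intro u hu h c x hx hz
    refine h 0 le_rfl (x 0) (hx 0 (by omega)) c ?_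
    intro j hj
    exact hz.2 0 j (by omega) (by simp [Nat.le_zero.1 hj])
  | succ n ih =>
    intro u hu h c x hx hz
    have hu0 : ∀ t ∈ I, u 0 t ≠ 0 := by
      intro t ht h0
      have := h 0 (by omega) t ht (fun _ => 1) (by
        intro j hj
        obtain rfl : j = 0 := by omega
        simpa using h0) 0 le_rfl
      simp at this
    have hinv : ContDiffOn ℝ (⊤ : ℕ∞) (fun t => (u 0 t)⁻¹) I := (hu 0).inv hu0
    have hq : ∀ i, ContDiffOn ℝ (⊤ : ℕ∞) (fun t => u i t * (u 0 t)⁻¹) I :=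
      fun i => (hu i).mul hinv
    have hS : ∀ (k : ℕ) (c : ℕ → ℝ),
        ContDiffOn ℝ (⊤ : ℕ∞) (fun t => ∑ i ∈ Finset.range k, c i * u i t) I :=
      fun k c => ContDiffOn.sum fun i _ => contDiffOn_const.mul (hu i)
    set v : ℕ → ℝ → ℝ := fun i => deriv (fun t => u (i + 1) t * (u 0 t)⁻¹) with hv
    have hvs : ∀ i, ContDiffOn ℝ (⊤ : ℕ∞) (v i) I := by
      intro i
      exact (hq (i + 1)).deriv_of_isOpen hIo (by simp)
    -- derivative of the quotient
    have hder : ∀ (k : ℕ) (c : ℕ → ℝ), ∀ t ∈ I,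
        deriv ((fun t => ∑ i ∈ Finset.range (k + 1 + 1), c i * u i t) * fun t => (u 0 t)⁻¹) t =
          ∑ i ∈ Finset.range (k + 1), c (i + 1) * v i t := by
      intro k c t ht
      have e1 : ((fun t => ∑ i ∈ Finset.range (k + 1 + 1), c i * u i t) * fun t => (u 0 t)⁻¹)
          =ᶠ[nhds t] fun t => (∑ i ∈ Finset.range (k + 1), c (i + 1) * (u (i + 1) t * (u 0 t)⁻¹))
            + c 0 := by
        filter_upwards [hIo.mem_nhds ht] with s hs
        simp only [Pi.mul_apply]
        rw [Finset.sum_range_succ', add_mul, Finset.sum_mul, mul_assoc,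
          mul_inv_cancel₀ (hu0 s hs), mul_one]
        simp only [mul_assoc]
      rw [e1.deriv_eq, deriv_add_const, deriv_fun_sum]
      · apply Finset.sum_congr rfl
        intro i _
        rw [deriv_const_mul_field]
      · intro i _
        exact (((hq (i + 1)).contDiffAt (hIo.mem_nhds ht)).differentiableAt (by simp)).const_mul _
    have hvk : ∀ i ≤ n, (fun i => c (i + 1)) i = 0 := by
      have hz' : ZSeq ((fun t => ∑ i ∈ Finset.range (n + 1 + 1), c i * u i t) * fun t => (u 0 t)⁻¹)
          (n + 1 + 1) x := by
        refine ⟨hz.1, fun i j hij he => ?_⟩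
        have hxi := hIo.mem_nhds (hx i (by omega))
        exact leib ((hS _ _).contDiffAt hxi) (hinv.contDiffAt hxi) (zseq_low hz hij he)
      obtain ⟨y, hy, hyI⟩ := zseq_rolle hI (((hS _ _).mul hinv).continuousOn) hz' hx
      refine ih v hvs ?_ (fun i => c (i + 1)) y hyI ⟨hy.1, fun i j hij he => ?_⟩
      · intro k hk t ht d hd
        set e : ℕ → ℝ := fun i => if i = 0 then
          -(∑ i ∈ Finset.range (k + 1), d i * u (i + 1) t) * (u 0 t)⁻¹ else d (i - 1) with he
        have := h (k + 1) (by omega) t ht e ?_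
        · intro i hi
          simpa [he] using this (i + 1) (by omega)
        · set G := fun t => ∑ i ∈ Finset.range (k + 1 + 1), e i * u i t with hG
          have hG0 : G t = 0 := by
            simp only [hG]
            rw [Finset.sum_range_succ']
            simp only [he]
            simp
            rw [mul_assoc, inv_mul_cancel₀ (hu0 t ht)]; ring
          have hGs : ContDiffAt ℝ (⊤ : ℕ∞) G t := (hS _ _).contDiffAt (hIo.mem_nhds ht)
          have hgs : ∀ j ≤ k + 1, iteratedDeriv j (G * fun t => (u 0 t)⁻¹) t = 0 := by
            intro j hj
            rcases j with _ | j
            · simp [hG0]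
            · rw [iteratedDeriv_succ', Filter.EventuallyEq.iteratedDeriv_eq j
                (g := fun t => ∑ i ∈ Finset.range (k + 1), d i * v i t)]
              · exact hd j (by omega)
              · filter_upwards [hIo.mem_nhds ht] with s hs
                rw [hder k e s hs]
                simp [he]
          intro j hj
          have e2 : G =ᶠ[nhds t] (G * fun t => (u 0 t)⁻¹) * u 0 := by
            filter_upwards [hIo.mem_nhds ht] with s hs
            simp only [Pi.mul_apply]
            rw [mul_assoc, inv_mul_cancel₀ (hu0 s hs), mul_one]
          rw [e2.iteratedDeriv_eq]
          exact leib (hGs.mul (hinv.contDiffAt (hIo.mem_nhds ht)))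
            ((hu 0).contDiffAt (hIo.mem_nhds ht)) (fun l hl => hgs l (by omega))
      · rw [← hy.2 i j hij he]
        apply Filter.EventuallyEq.iteratedDeriv_eq
        filter_upwards [hIo.mem_nhds (hyI i (by omega))] with s hs
        exact (hder n c s hs).symm
    have h00 : c 0 = 0 := by
      have := hz.2 0 0 (by omega) rfl
      simp only [iteratedDeriv_zero] at this
      rw [Finset.sum_range_succ', Finset.sum_eq_zero] at this
      · simpa [hu0 _ (hx 0 (by omega))] using this
      · intro i hi
        rw [show c (i + 1) = 0 from hvk i (by simp at hi; omega), zero_mul]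
    intro i hi
    rcases i with _ | i
    · exact h00
    · exact hvk i (by omega)

lemma iterD_iterD (F : ℝ → ℝ) (j k : ℕ) :
    iteratedDeriv j (iteratedDeriv k F) = iteratedDeriv (j + k) F := by
  simp only [iteratedDeriv_eq_iterate, Function.iterate_add_apply]

lemma smooth_iter {F : ℝ → ℝ} (hF : ContDiff ℝ (⊤ : ℕ∞) F) (k : ℕ) :
    ContDiff ℝ (⊤ : ℕ∞) (iteratedDeriv k F) := by
  rw [iteratedDeriv_eq_iterate]
  exact hF.iterate_deriv k

lemma smooth_nat {F : ℝ → ℝ} (hF : ContDiff ℝ (⊤ : ℕ∞) F) (k : ℕ) (x : ℝ) :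
    ContDiffAt ℝ k F x := (hF.of_le (by exact_mod_cast le_top)).contDiffAt

lemma hasDeriv_iter {F : ℝ → ℝ} (hF : ContDiff ℝ (⊤ : ℕ∞) F) (k : ℕ) (x : ℝ) :
    HasDerivAt (iteratedDeriv k F) (iteratedDeriv (k + 1) F x) x := by
  rw [iteratedDeriv_succ]
  exact ((smooth_iter hF k).differentiable (by simp) x).hasDerivAt

lemma iterD_lin {ι : Type*} (s : Finset ι) (c : ι → ℝ) (u : ι → ℝ → ℝ)
    (hu : ∀ i, ContDiff ℝ (⊤ : ℕ∞) (u i)) (j : ℕ) (x : ℝ) :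
    iteratedDeriv j (fun t => ∑ i ∈ s, c i * u i t) x = ∑ i ∈ s, c i * iteratedDeriv j (u i) x := by
  rw [iteratedDeriv_fun_sum]
  · apply Finset.sum_congr rfl
    intro i _
    rw [iteratedDeriv_const_mul_field]
  · intro i _
    exact contDiffAt_const.mul (smooth_nat (hu i) j x)

section ker
variable {n : ℕ} {a : Fin (n + 1) → ℝ}

lemma ker_deriv {F : ℝ → ℝ} (hF : F ∈ kerOp n a) : deriv F ∈ kerOp n a := by
  refine ⟨by simpa using smooth_iter hF.1 1, fun x => ?_⟩
  simp only [← iteratedDeriv_succ']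
  have h1 : HasDerivAt (fun x => iteratedDeriv (n + 1) F x +
      ∑ i : Fin (n + 1), a i * iteratedDeriv (i : ℕ) F x)
      (iteratedDeriv (n + 1 + 1) F x + ∑ i : Fin (n + 1), a i * iteratedDeriv ((i : ℕ) + 1) F x)
      x := (hasDeriv_iter hF.1 _ x).add
        (HasDerivAt.fun_sum fun i _ => (hasDeriv_iter hF.1 _ x).const_mul _)
  rw [funext hF.2] at h1
  exact h1.unique (hasDerivAt_const x 0)

lemma ker_iter {F : ℝ → ℝ} (hF : F ∈ kerOp n a) (k : ℕ) : iteratedDeriv k F ∈ kerOp n a := by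
  induction k with
  | zero => simpa using hF
  | succ k ih => rw [iteratedDeriv_succ]; exact ker_deriv ih

lemma ker_lin (s : Finset ℕ) (c : ℕ → ℝ) (u : ℕ → ℝ → ℝ) (hu : ∀ i, u i ∈ kerOp n a) :
    (fun t => ∑ i ∈ s, c i * u i t) ∈ kerOp n a := by
  refine ⟨ContDiff.sum fun i _ => contDiff_const.mul (hu i).1, fun x => ?_⟩
  simp only [iterD_lin s c u (fun i => (hu i).1)]
  simp only [Finset.mul_sum]
  rw [Finset.sum_comm, ← Finset.sum_add_distrib]
  apply Finset.sum_eq_zero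
  intro i _
  rw [← mul_zero (c i), ← (hu i).2 x, mul_add, Finset.mul_sum]
  congr 1
  apply Finset.sum_congr rfl
  intros; ring

lemma iterD_sub_mul {F G : ℝ → ℝ} (hF : ContDiff ℝ (⊤ : ℕ∞) F) (hG : ContDiff ℝ (⊤ : ℕ∞) G) (c : ℝ)
    (j : ℕ) (x : ℝ) : iteratedDeriv j (fun t => F t - c * G t) x =
      iteratedDeriv j F x - c * iteratedDeriv j G x := by
  have := iteratedDeriv_sub (smooth_nat hF j x)
    (smooth_nat ((contDiff_const (c := c)).mul hG) j x)
  rw [iteratedDeriv_const_mul_field] at this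
  exact this

lemma ker_sub_mul {F G : ℝ → ℝ} (hF : F ∈ kerOp n a) (hG : G ∈ kerOp n a) (c : ℝ) :
    (fun t => F t - c * G t) ∈ kerOp n a := by
  refine ⟨hF.1.sub (contDiff_const.mul hG.1), fun x => ?_⟩
  simp only [iterD_sub_mul hF.1 hG.1, mul_sub, Finset.sum_sub_distrib]
  have h1 := hF.2 x
  have h2 := hG.2 x
  have h3 : ∑ i : Fin (n + 1), a i * (c * iteratedDeriv (i : ℕ) G x) =
      c * ∑ i : Fin (n + 1), a i * iteratedDeriv (i : ℕ) G x := by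
    rw [Finset.mul_sum]; apply Finset.sum_congr rfl; intros; ring
  rw [h3]
  linear_combination h1 - c * h2

lemma ker_unique {F : ℝ → ℝ} (hF : F ∈ kerOp n a) (x₀ : ℝ)
    (h : ∀ j ≤ n, iteratedDeriv j F x₀ = 0) : F = 0 := by
  let A : (Fin (n + 1) → ℝ) →ₗ[ℝ] (Fin (n + 1) → ℝ) :=
    { toFun := fun y j => if h : (j : ℕ) + 1 < n + 1 then y ⟨j + 1, h⟩ else -∑ i, a i * y i
      map_add' := by
        intro y z; ext j; simp only [Pi.add_apply]
        split_ifs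
        · rfl
        · simp only [mul_add, Finset.sum_add_distrib]; ring
      map_smul' := by
        intro c y; ext j; simp only [Pi.smul_apply, smul_eq_mul, RingHom.id_apply]
        split_ifs
        · rfl
        · rw [mul_neg, Finset.mul_sum]; congr 1; apply Finset.sum_congr rfl; intros; ring }
  let B := LinearMap.toContinuousLinearMap A
  have key := ODE_solution_unique_univ (v := fun _ y => B y) (s := fun _ => Set.univ)
    (K := ‖B‖₊) (f := fun t (j : Fin (n + 1)) => iteratedDeriv (j : ℕ) F t)
    (g := fun _ => 0) (t₀ := x₀) (fun t => B.lipschitz.lipschitzOnWith) ?_ ?_ ?_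
  · ext t
    simpa using congrFun (congrFun key t) 0
  · intro t
    refine ⟨?_, Set.mem_univ _⟩
    rw [hasDerivAt_pi]
    intro j
    have := hasDeriv_iter hF.1 j t
    refine this.congr_deriv (Eq.symm ?_)
    change (if h : (j : ℕ) + 1 < n + 1 then _ else _) = _
    split_ifs with h
    · rfl
    · have hj : (j : ℕ) = n := by omega
      rw [hj]
      linarith [hF.2 t]
  · intro t
    refine ⟨?_, Set.mem_univ _⟩
    rw [map_zero]
    exact hasDerivAt_const _ _
  · ext j
    exact h j (by omega)

section S
variable {S : ℝ → ℝ}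

lemma expand (hS : S ∈ kerOp n a) (hS0 : ∀ j < n, iteratedDeriv j S 0 = 0)
    (hSn : iteratedDeriv n S 0 = 1)
    (k : ℕ) (hk : k ≤ n + 1) : ∀ G ∈ kerOp n a, VanishAtLeast G (n + 1 - k) 0 →
    ∃ c : ℕ → ℝ, G = fun t => ∑ i ∈ Finset.range k, c i * iteratedDeriv i S t := by
  induction k with
  | zero =>
    intro G hG hv
    refine ⟨0, ?_⟩
    rw [ker_unique hG 0 (fun j hj => hv j (by omega))]
    ext; simp
  | succ k ih =>
    intro G hG hv
    set d := iteratedDeriv (n - k) G 0 with hd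
    obtain ⟨c, hc⟩ := ih (by omega) _ (ker_sub_mul hG (ker_iter hS k) d) (by
      intro j hj
      rw [iterD_sub_mul hG.1 (ker_iter hS k).1, iterD_iterD]
      rcases Nat.lt_or_ge j (n - k) with h | h
      · rw [hv j (by omega), hS0 _ (by omega)]; simp
      · obtain rfl : j = n - k := by omega
        rw [show n - k + k = n by omega, hSn, hd]; ring)
    refine ⟨fun i => if i = k then d else c i, ?_⟩
    ext t
    have := congrFun hc t
    rw [Finset.sum_range_succ]
    simp only [if_true]
    rw [Finset.sum_congr rfl (g := fun i => c i * iteratedDeriv i S t)]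
    · linarith
    · intro i hi
      rw [if_neg (by simp at hi; omega)]

lemma lin_iterD (hS : S ∈ kerOp n a) (k : ℕ) (c : ℕ → ℝ) (j : ℕ) (x : ℝ) :
    iteratedDeriv j (fun t => ∑ i ∈ Finset.range k, c i * iteratedDeriv i S t) x =
      ∑ i ∈ Finset.range k, c i * iteratedDeriv (j + i) S x := by
  rw [iterD_lin _ _ _ (fun i => (ker_iter hS i).1)]
  simp only [iterD_iterD]

lemma lin_van (hS : S ∈ kerOp n a) (hS0 : ∀ j < n, iteratedDeriv j S 0 = 0)
    (k : ℕ) (c : ℕ → ℝ) :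
    VanishAtLeast (fun t => ∑ i ∈ Finset.range k, c i * iteratedDeriv i S t) (n + 1 - k) 0 := by
  intro j hj
  rw [lin_iterD hS]
  apply Finset.sum_eq_zero
  intro i hi
  simp at hi
  rw [hS0 _ (by omega), mul_zero]

lemma lin_indep (hS : S ∈ kerOp n a) (hS0 : ∀ j < n, iteratedDeriv j S 0 = 0)
    (hSn : iteratedDeriv n S 0 = 1)
    (k : ℕ) (hk : k ≤ n + 1) (c : ℕ → ℝ)
    (h : (fun t => ∑ i ∈ Finset.range k, c i * iteratedDeriv i S t) = 0) : ∀ i < k, c i = 0 := by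
  induction k with
  | zero => intro i hi; omega
  | succ k ih =>
    have hk0 : c k = 0 := by
      have := lin_iterD hS (k + 1) c (n - k) 0
      rw [h, Finset.sum_range_succ, Finset.sum_eq_zero, show n - k + k = n by omega, hSn] at this
      · simpa using this.symm
      · intro i hi
        simp at hi
        rw [hS0 _ (by omega), mul_zero]
    have := ih (by omega) (by
      rw [← h]; ext t; rw [Finset.sum_range_succ, hk0]; simp)
    intro i hi
    rcases Nat.lt_or_ge i k with h | h
    · exact this i h
    · obtain rfl : i = k := by omega
      exact hk0

lemma wron_zero_iff (hS : S ∈ kerOp n a)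
    (k : ℕ) (x : ℝ) : WronS S k x = 0 ↔
    ∃ c : ℕ → ℝ, (∃ i ≤ k, c i ≠ 0) ∧ ∀ j ≤ k,
      iteratedDeriv j (fun t => ∑ i ∈ Finset.range (k + 1), c i * iteratedDeriv i S t) x = 0 := by
  unfold WronS
  rw [← Matrix.exists_mulVec_eq_zero_iff]
  constructor
  · rintro ⟨v, hv, h⟩
    refine ⟨fun i => if h : i < k + 1 then v ⟨i, h⟩ else 0, ?_, ?_⟩
    · obtain ⟨i, hi⟩ := Function.ne_iff.1 hv
      exact ⟨i, by omega, by beta_reduce; rw [dif_pos i.2]; exact hi⟩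
    · intro j hj
      rw [lin_iterD hS, Finset.sum_range]
      have := congrFun h ⟨j, by omega⟩
      simp only [Matrix.mulVec, dotProduct, Matrix.of_apply, Pi.zero_apply] at this
      rw [← this]
      apply Finset.sum_congr rfl
      intro i _
      rw [dif_pos i.2, mul_comm]
  · rintro ⟨c, ⟨i, hi, hci⟩, h⟩
    refine ⟨fun i => c i, ?_, ?_⟩
    · exact Function.ne_iff.2 ⟨⟨i, by omega⟩, by simpa using hci⟩
    · ext j
      have := h j (by omega)
      rw [lin_iterD hS, Finset.sum_range] at this
      simp only [Matrix.mulVec, dotProduct, Matrix.of_apply, Pi.zero_apply]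
      rw [← this]
      apply Finset.sum_congr rfl
      intro i _
      rw [mul_comm]

end S

lemma ker_shift {F : ℝ → ℝ} (hF : F ∈ kerOp n a) (e : ℝ) :
    (fun t => F (t - e)) ∈ kerOp n a := by
  refine ⟨hF.1.comp (contDiff_id.sub contDiff_const), fun x => ?_⟩
  simp only [iteratedDeriv_comp_sub_const]
  exact hF.2 _

lemma ker_refl (hpar : ∀ i : Fin (n + 1), a i * (-1) ^ (i : ℕ) = (-1) ^ (n + 1) * a i)
    {F : ℝ → ℝ} (hF : F ∈ kerOp n a) (e : ℝ) :
    (fun t => F (e - t)) ∈ kerOp n a := by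
  refine ⟨hF.1.comp (contDiff_const.sub contDiff_id), fun x => ?_⟩
  simp only [iteratedDeriv_comp_const_sub, smul_eq_mul]
  simp only [← mul_assoc, hpar]
  simp only [mul_assoc]
  rw [← Finset.mul_sum, ← mul_add, hF.2, mul_zero]

lemma zseq_iter {F : ℝ → ℝ} (hF : ContDiff ℝ (⊤ : ℕ∞) F) {I : Set ℝ} (hI : I.OrdConnected)
    {N : ℕ} (k : ℕ) {x : ℕ → ℝ} (hx : ∀ i < N + k, x i ∈ I) (h : ZSeq F (N + k) x) :
    ∃ y, ZSeq (iteratedDeriv k F) N y ∧ ∀ i < N, y i ∈ I := by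
  induction k generalizing N with
  | zero => exact ⟨x, by simpa using h, hx⟩
  | succ k ih =>
    obtain ⟨y, hy, hyI⟩ := ih (N := N + 1) (fun i hi => hx i (by omega))
      (by rwa [show N + 1 + k = N + (k + 1) by omega])
    rw [iteratedDeriv_succ]
    exact zseq_rolle hI (smooth_iter hF k).continuous.continuousOn hy hyI

lemma small_ec (n : ℕ) (a : Fin (n + 1) → ℝ) : ∃ h > 0, IsECOn n a (Set.Icc 0 h) := by
  set C : ℝ := 1 + ∑ i, |a i| with hC
  have hC1 : 1 ≤ C := by
    have : 0 ≤ ∑ i, |a i| := Finset.sum_nonneg fun i _ => abs_nonneg _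
    linarith
  have hnpos : (0 : ℝ) < n + 1 := by positivity
  set h : ℝ := 1 / (2 * (n + 1) * C) with hh
  have hpos : 0 < h := by positivity
  refine ⟨h, hpos, ?_⟩
  intro F hF hF0 r xs m hxs hinj hm1 hm2 hv
  by_contra hcon
  push Not at hcon
  apply hF0
  obtain ⟨x, hz, hxx⟩ := exists_zseq hinj hv (N := n + 1) hcon
  have hxI : ∀ i < n + 1, x i ∈ Set.Icc 0 h := by
    intro i hi
    obtain ⟨j, hj⟩ := hxx i hi
    rw [hj]; exact hxs j
  have hzero : ∀ j ≤ n, ∃ z ∈ Set.Icc 0 h, iteratedDeriv j F z = 0 := by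
    intro j hj
    obtain ⟨y, hy, hyI⟩ := zseq_iter hF.1 Set.ordConnected_Icc (N := n + 1 - j) j
      (by rwa [show n + 1 - j + j = n + 1 by omega])
      (by rwa [show n + 1 - j + j = n + 1 by omega])
    exact ⟨y 0, hyI 0 (by omega), by simpa using hy.2 0 0 (by omega) rfl⟩
  set Φ : ℝ → ℝ := fun t => ∑ j ∈ Finset.range (n + 1), |iteratedDeriv j F t| with hΦ
  have hΦc : Continuous Φ := continuous_finsetSum _ fun j _ => (smooth_iter hF.1 j).continuous.abs
  obtain ⟨p, hp, hpmax⟩ := isCompact_Icc.exists_isMaxOn (Set.nonempty_Icc.2 hpos.le)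
    hΦc.continuousOn
  have hle : ∀ t, ∀ j ≤ n, |iteratedDeriv j F t| ≤ Φ t := by
    intro t j hj
    exact Finset.single_le_sum (f := fun j => |iteratedDeriv j F t|) (fun i _ => abs_nonneg _)
      (by simp; omega)
  have hΦ0 : ∀ t, 0 ≤ Φ t := fun t => Finset.sum_nonneg fun i _ => abs_nonneg _
  have hle' : ∀ t, ∀ j ≤ n, |iteratedDeriv (j + 1) F t| ≤ C * Φ t := by
    intro t j hj
    rcases hj.eq_or_lt with rfl | hlt
    · have h1 : iteratedDeriv (j + 1) F t = -∑ i : Fin (j + 1), a i * iteratedDeriv (i : ℕ) F t := by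
        linarith [hF.2 t]
      rw [h1, abs_neg]
      calc |∑ i : Fin (j + 1), a i * iteratedDeriv (i : ℕ) F t|
          ≤ ∑ i : Fin (j + 1), |a i * iteratedDeriv (i : ℕ) F t| := Finset.abs_sum_le_sum_abs _ _
        _ ≤ ∑ i : Fin (j + 1), |a i| * Φ t := by
          apply Finset.sum_le_sum
          intro i _
          rw [abs_mul]
          exact mul_le_mul_of_nonneg_left (hle t i (by omega)) (abs_nonneg _)
        _ ≤ C * Φ t := by
          rw [← Finset.sum_mul]
          apply mul_le_mul_of_nonneg_right _ (hΦ0 t)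
          linarith
    · exact (hle t (j + 1) hlt).trans (le_mul_of_one_le_left (hΦ0 t) hC1)
  have hb : ∀ j ∈ Finset.range (n + 1), |iteratedDeriv j F p| ≤ C * Φ p * h := by
    intro j hj
    have hj' : j ≤ n := by simp at hj; omega
    obtain ⟨z, hz, hz0⟩ := hzero j hj'
    have := (convex_Icc (0 : ℝ) h).norm_image_sub_le_of_norm_deriv_le (f := iteratedDeriv j F)
      (C := C * Φ p) (fun t _ => (hasDeriv_iter hF.1 j t).differentiableAt) (by
        intro t ht
        rw [← iteratedDeriv_succ, Real.norm_eq_abs]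
        refine (hle' t j hj').trans ?_
        have : Φ t ≤ Φ p := hpmax ht
        gcongr) hz hp
    rw [hz0, sub_zero, Real.norm_eq_abs, Real.norm_eq_abs] at this
    refine this.trans ?_
    apply mul_le_mul_of_nonneg_left _ (mul_nonneg (by linarith) (hΦ0 p))
    rw [abs_le]; constructor <;> linarith [hz.1, hz.2, hp.1, hp.2]
  have hsum : Φ p ≤ (n + 1) * (C * Φ p * h) := by
    have := Finset.sum_le_card_nsmul _ _ _ hb
    simpa using this
  have hhalf : (n + 1) * (C * Φ p * h) = Φ p / 2 := by
    rw [hh]; field_simp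
  have hp0 : Φ p = 0 := by linarith [hΦ0 p]
  refine ker_unique hF p fun j hj => ?_
  have := hle p j hj
  rw [hp0] at this
  exact abs_eq_zero.1 (le_antisymm this (abs_nonneg _))

lemma parity_coeff
    (hparity :
      (∀ x : ℝ, (-x) ^ (n + 1) + ∑ i : Fin (n + 1), a i * (-x) ^ (i : ℕ) =
          x ^ (n + 1) + ∑ i : Fin (n + 1), a i * x ^ (i : ℕ)) ∨
      (∀ x : ℝ, (-x) ^ (n + 1) + ∑ i : Fin (n + 1), a i * (-x) ^ (i : ℕ) =
          -(x ^ (n + 1) + ∑ i : Fin (n + 1), a i * x ^ (i : ℕ)))) :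
    ∀ i : Fin (n + 1), a i * (-1) ^ (i : ℕ) = (-1) ^ (n + 1) * a i := by
  obtain ⟨s, hs⟩ : ∃ s : ℝ, ∀ x : ℝ, (-x) ^ (n + 1) + ∑ i : Fin (n + 1), a i * (-x) ^ (i : ℕ) =
          s * (x ^ (n + 1) + ∑ i : Fin (n + 1), a i * x ^ (i : ℕ)) := by
    rcases hparity with h | h
    · exact ⟨1, by simpa using h⟩
    · exact ⟨-1, by simpa using h⟩
  open Polynomial in
  have hP : (C ((-1 : ℝ) ^ (n + 1)) * X ^ (n + 1) +
      ∑ i : Fin (n + 1), C (a i * (-1) ^ (i : ℕ)) * X ^ (i : ℕ) : ℝ[X]) =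
      C s * (X ^ (n + 1) + ∑ i : Fin (n + 1), C (a i) * X ^ (i : ℕ)) := by
    apply Polynomial.funext
    intro x
    simp only [eval_add, eval_mul, eval_C, eval_pow, eval_X, eval_finsetSum]
    rw [← hs x, neg_pow x]
    congr 1
    apply Finset.sum_congr rfl
    intro i _
    rw [neg_pow x]; ring
  have h1 : (-1 : ℝ) ^ (n + 1) = s := by
    have := congrArg (fun p => Polynomial.coeff p (n + 1)) hP
    simp only [Polynomial.coeff_add, Polynomial.coeff_C_mul, Polynomial.coeff_X_pow,
      Polynomial.finsetSum_coeff] at this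
    rw [Finset.sum_eq_zero, Finset.sum_eq_zero] at this
    · simpa using this
    · intro i _; rw [if_neg (by omega), mul_zero]
    · intro i _; rw [if_neg (by omega), mul_zero]
  intro j
  have := congrArg (fun p => Polynomial.coeff p (j : ℕ)) hP
  simp only [Polynomial.coeff_add, Polynomial.coeff_C_mul, Polynomial.coeff_X_pow,
    Polynomial.finsetSum_coeff] at this
  rw [if_neg (by omega)] at this
  simp only [Fin.val_inj, mul_ite, mul_one, mul_zero, Finset.sum_ite_eq, Finset.mem_univ,
    if_true, zero_add] at this
  rw [h1, this]

end ker

lemma ec_of_wron {n : ℕ} (hn : 1 ≤ n) {a : Fin (n + 1) → ℝ}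
    (hpar : ∀ i : Fin (n + 1), a i * (-1) ^ (i : ℕ) = (-1) ^ (n + 1) * a i)
    {S : ℝ → ℝ} (hS : S ∈ kerOp n a)
    (hS0 : ∀ j < n, iteratedDeriv j S 0 = 0) (hSn : iteratedDeriv n S 0 = 1)
    {M h : ℝ} (hhM : h < M)
    (hW : ∀ k ≤ (n - 1) / 2, ∀ x, 0 < x → x < M → WronS S k x ≠ 0) :
    IsECOn n a (Set.Icc 0 h) := by
  have hW' : ∀ k ≤ n, ∀ x ∈ Set.Ioo 0 M, ∀ c : ℕ → ℝ,
      (∀ j ≤ k, iteratedDeriv j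
        (fun t => ∑ i ∈ Finset.range (k + 1), c i * iteratedDeriv i S t) x = 0) →
      ∀ i ≤ k, c i = 0 := by
    have base : ∀ k ≤ (n - 1) / 2, ∀ x ∈ Set.Ioo 0 M, ∀ c : ℕ → ℝ,
      (∀ j ≤ k, iteratedDeriv j
        (fun t => ∑ i ∈ Finset.range (k + 1), c i * iteratedDeriv i S t) x = 0) →
      ∀ i ≤ k, c i = 0 := by
      intro k hk x hx c hc i hi
      by_contra hne
      exact hW k hk x hx.1 hx.2 ((wron_zero_iff hS k x).2 ⟨c, ⟨i, hi, hne⟩, hc⟩)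
    intro k hk x hx c hc
    set F : ℝ → ℝ := fun t => ∑ i ∈ Finset.range (k + 1), c i * iteratedDeriv i S t with hFdef
    have hF : F ∈ kerOp n a := ker_lin _ _ _ (ker_iter hS)
    have hFv : VanishAtLeast F (n + 1 - (k + 1)) 0 := lin_van hS hS0 (k + 1) c
    by_cases hk1 : k ≤ (n - 1) / 2
    · exact base k hk1 x hx c hc
    have hF0 : F = 0 := by
      rcases hk.eq_or_lt with rfl | hlt
      · exact ker_unique hF x hc
      · have hG := ker_refl hpar hF x
        obtain ⟨d, hd⟩ := expand hS hS0 hSn (n - k) (by omega) _ hG (by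
          intro j hj
          rw [iteratedDeriv_comp_const_sub]
          simp [hc j (by omega)])
        have hd0 := base (n - 1 - k) (by omega) x hx d (by
          intro j hj
          rw [show n - 1 - k + 1 = n - k by omega, ← hd, iteratedDeriv_comp_const_sub]
          simp [hFv j (by omega)])
        ext t
        have := congrFun hd (x - t)
        rw [Finset.sum_eq_zero] at this
        · simpa using this
        · intro i hi
          simp at hi
          rw [hd0 i (by omega), zero_mul]
    intro i hi
    exact lin_indep hS hS0 hSn (k + 1) (by omega) c hF0 i (by omega)
  intro F hF hF0 r xs m hxs hinj hm1 hm2 hv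
  by_contra hcon
  push Not at hcon
  apply hF0
  set e := (M - h) / 2 with he
  have hepos : 0 < e := by rw [he]; linarith
  have hG := ker_shift hF e
  obtain ⟨c, hc⟩ := expand hS hS0 hSn (n + 1) le_rfl _ hG (by intro j hj; omega)
  obtain ⟨x, hz, hxx⟩ := exists_zseq hinj hv (N := n + 1) hcon
  have hc0 := polya Set.ordConnected_Ioo isOpen_Ioo n (fun i => iteratedDeriv i S)
    (fun i => (ker_iter hS i).1.contDiffOn) hW' c (fun i => x i + e) (by
      intro i hi
      obtain ⟨j, hj⟩ := hxx i hi
      have := hxs j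
      rw [← hj] at this
      constructor <;> linarith [this.1, this.2]) (by
      rw [← hc]
      refine ⟨fun i j hij hj => by simpa using hz.1 i j hij hj, fun i j hij hx => ?_⟩
      rw [iteratedDeriv_comp_sub_const]
      simpa using hz.2 i j hij (by simpa using hx))
  ext t
  have := congrFun hc (t + e)
  rw [Finset.sum_eq_zero] at this
  · simpa using this
  · intro i hi
    simp at hi
    rw [hc0 i (by omega), zero_mul]

lemma not_ec_of_wron {n : ℕ} {a : Fin (n + 1) → ℝ}
    {S : ℝ → ℝ} (hS : S ∈ kerOp n a)
    (hS0 : ∀ j < n, iteratedDeriv j S 0 = 0) (hSn : iteratedDeriv n S 0 = 1)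
    {k : ℕ} (hk : k < n) {x h : ℝ} (hx : 0 < x) (hxh : x ≤ h) (hW : WronS S k x = 0) :
    ¬ IsECOn n a (Set.Icc 0 h) := by
  intro hec
  obtain ⟨c, ⟨i, hi, hci⟩, hc⟩ := (wron_zero_iff hS k x).1 hW
  have hF := ker_lin (Finset.range (k + 1)) c _ (ker_iter hS)
  have hv := lin_van hS hS0 (k + 1) c
  have := hec _ hF (fun h0 => hci (lin_indep hS hS0 hSn (k + 1) (by omega) c h0 i (by omega)))
    2 ![0, x] ![n - k, k + 1] ?_ ?_ ?_ ?_ ?_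
  · simp [Fin.sum_univ_two] at this
    omega
  · intro i
    fin_cases i
    · simp; linarith
    · simp; exact ⟨hx.le, hxh⟩
  · intro i j
    fin_cases i <;> fin_cases j <;> simp [hx.ne, hx.ne']
  · intro i
    fin_cases i
    · simp; omega
    · simp
  · intro i
    fin_cases i
    · simp; omega
    · simp; omega
  · intro i
    fin_cases i
    · intro j hj
      exact hv j (by simp at hj; omega)
    · intro j hj
      exact hc j (by simp at hj; omega)

/-- if moreover the characteristic polynomial is even or odd, then
`ℓ_L = min_{0 ≤ k ≤ ⌊(n-1)/2⌋} inf {h > 0 | W_k(h) = 0}` (with `inf ∅ = +∞`). -/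
theorem stmt4 (n : ℕ) (hn : 1 ≤ n) (a : Fin (n + 1) → ℝ)
    (hparity :
      (∀ x : ℝ, (-x) ^ (n + 1) + ∑ i : Fin (n + 1), a i * (-x) ^ (i : ℕ) =
          x ^ (n + 1) + ∑ i : Fin (n + 1), a i * x ^ (i : ℕ)) ∨
      (∀ x : ℝ, (-x) ^ (n + 1) + ∑ i : Fin (n + 1), a i * (-x) ^ (i : ℕ) =
          -(x ^ (n + 1) + ∑ i : Fin (n + 1), a i * x ^ (i : ℕ))))
    (hnonreal : ∃ z : ℂ,
      z ^ (n + 1) + ∑ i : Fin (n + 1), (a i : ℂ) * z ^ (i : ℕ) = 0 ∧ z.im ≠ 0)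
    (S : ℝ → ℝ) (hS : S ∈ kerOp n a)
    (hS0 : ∀ j < n, iteratedDeriv j S 0 = 0) (hSn : iteratedDeriv n S 0 = 1) :
    critLen n a =
      ⨅ k : Fin ((n - 1) / 2 + 1),
        sInf {l : EReal | ∃ h : ℝ, l = (h : EReal) ∧ 0 < h ∧ WronS S (k : ℕ) h = 0} := by
  have hpar := parity_coeff hparity
  apply le_antisymm
  · refine le_iInf fun k => le_sInf ?_
    rintro _ ⟨x, rfl, hx, hW⟩
    refine sSup_le ?_
    rintro _ ⟨h, rfl, hh, hec⟩
    rw [EReal.coe_le_coe_iff]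
    by_contra hlt
    push Not at hlt
    exact not_ec_of_wron hS hS0 hSn (k := k) (by omega) hx hlt.le hW hec
  · refine le_of_forall_lt fun c hc => ?_
    by_cases hc0 : c < 0
    · obtain ⟨h, hh, hec⟩ := small_ec n a
      have : (h : EReal) ≤ critLen n a := le_sSup ⟨h, rfl, hh, hec⟩
      exact (hc0.trans (by exact_mod_cast hh)).trans_le this
    · push Not at hc0
      obtain ⟨h, hch, hh⟩ := EReal.lt_iff_exists_real_btwn.1 hc
      obtain ⟨M, hhM, hM⟩ := EReal.lt_iff_exists_real_btwn.1 hh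
      have hpos : 0 < h := by exact_mod_cast hc0.trans_lt hch
      refine hch.trans_le (le_sSup ⟨h, rfl, hpos, ?_⟩)
      refine ec_of_wron hn hpar hS hS0 hSn (M := M) (by exact_mod_cast hhM) ?_
      intro k hk x hx hxM hW
      have h1 := (hM.trans_le (iInf_le _ (⟨k, by omega⟩ : Fin ((n - 1) / 2 + 1)))).trans_le
        (sInf_le ⟨x, rfl, hx, hW⟩)
      exact absurd (EReal.coe_lt_coe_iff.1 h1) (by linarith)
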